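/- arXiv:0704.2866 — 2 statements merged into one kernel-verified Lean document; each statement's English description precedes it below -/
import Mathlib

section
/- Let R be a commutative Noetherian ring, let t ∈ R be an element that is not a zero-divisor, and let I ⊆ tR be an ideal such that, for some natural number N, one has I^(n+1) = t·I^n for all n ≥ N. If the zero locus V(I) is nowhere dense in Spec R, then I = tR. -/
/-- Multiplication of ideals by a non-zero-divisor is cancellative. -/
theorem Ideal.span_singleton_mul_left_cancel {R : Type*} [CommRing R] {t : R}
    (ht : t ∈ nonZeroDivisors R) {J K : Ideal R}
    (h : Ideal.span {t} * J = Ideal.span {t} * K) : J = K := by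
  have key : ∀ {A B : Ideal R}, Ideal.span {t} * A ≤ Ideal.span {t} * B → A ≤ B := by
    intro A B hAB x hx
    obtain ⟨y, hy, hyx⟩ := Ideal.mem_span_singleton_mul.mp
      (hAB (Ideal.mem_span_singleton_mul.mpr ⟨x, hx, rfl⟩))
    rwa [← (mul_cancel_left_mem_nonZeroDivisors ht).mp hyx]
  exact le_antisymm (key h.le) (key h.ge)

/-- An ideal contained in a principal ideal is a multiple of it. -/
theorem Ideal.exists_eq_span_singleton_mul {R : Type*} [CommRing R] {t : R} {I : Ideal R}
    (h : I ≤ Ideal.span {t}) : ∃ J : Ideal R, I = Ideal.span {t} * J := by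
  refine ⟨Submodule.comap (LinearMap.mulLeft R t) I, le_antisymm (fun x hx => ?_) ?_⟩
  · obtain ⟨y, rfl⟩ := Ideal.mem_span_singleton'.mp (h hx)
    exact Ideal.mem_span_singleton_mul.mpr
      ⟨y, by simpa [mul_comm] using hx, mul_comm _ _⟩
  · rw [Ideal.span_singleton_mul_le_iff]
    exact fun y hy => hy

/-- A finitely generated idempotent ideal whose zero locus is nowhere dense is the unit ideal. -/
theorem Ideal.eq_top_of_isIdempotentElem_of_interior_zeroLocus_eq_empty {R : Type*} [CommRing R]
    {J : Ideal R} (hfg : J.FG) (hJ : IsIdempotentElem J)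
    (h : interior (PrimeSpectrum.zeroLocus (J : Set R)) = ∅) : J = ⊤ := by
  obtain ⟨e, he, rfl⟩ := (Ideal.isIdempotentElem_iff_of_fg J hfg).mp hJ
  have hopen : IsOpen (PrimeSpectrum.zeroLocus ((Ideal.span {e} : Ideal R) : Set R)) := by
    rw [PrimeSpectrum.zeroLocus_span]
    exact (PrimeSpectrum.isClopen_iff_zeroLocus.mpr ⟨e, he, rfl⟩).isOpen
  rwa [hopen.interior_eq, PrimeSpectrum.zeroLocus_empty_iff_eq_top] at h


/-- Let `R` be a commutative Noetherian ring, `t ∈ R` a non-zero-divisor, and `I ⊆ tR`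
an ideal such that `I ^ (n+1) = t·I ^ n` for all sufficiently large `n`.  If the zero locus
`V(I)` is nowhere dense in `Spec R` (i.e. has empty interior, being closed), then `I = tR`. -/
theorem ideal_eq_span_singleton_of_pow_eq_smul_of_nowhereDense
    {R : Type*} [CommRing R] [IsNoetherianRing R]
    (t : R) (ht : t ∈ nonZeroDivisors R)
    (I : Ideal R) (hIt : I ≤ Ideal.span {t})
    (N : ℕ) (hpow : ∀ n, N ≤ n → I ^ (n + 1) = Ideal.span {t} * I ^ n)
    (hnwd : interior (PrimeSpectrum.zeroLocus (I : Set R)) = ∅) :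
    I = Ideal.span {t} := by
  obtain ⟨J, rfl⟩ := Ideal.exists_eq_span_singleton_mul hIt
  have hJ : ∀ n, N ≤ n → J ^ (n + 1) = J ^ n := fun n hn => by
    refine Ideal.span_singleton_mul_left_cancel (pow_mem ht (n + 1)) ?_
    have := hpow n hn
    rwa [mul_pow, mul_pow, ← mul_assoc, ← pow_succ', Ideal.span_singleton_pow] at this
  have hstab : ∀ k, J ^ (N + 1 + k) = J ^ (N + 1) := fun k => by
    induction k with
    | zero => rfl
    | succ k ih => rw [← add_assoc, hJ _ (by omega), ih]
  have htop : J ^ (N + 1) = ⊤ := by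
    refine Ideal.eq_top_of_isIdempotentElem_of_interior_zeroLocus_eq_empty
      (IsNoetherian.noetherian _) (by rw [IsIdempotentElem, ← pow_add, hstab]) ?_
    rw [← Set.subset_empty_iff, ← hnwd]
    refine interior_mono fun p hp => ?_
    exact Ideal.mul_le_right.trans (p.isPrime.le_of_pow_le hp)
  rw [eq_top_iff.mpr (htop.ge.trans (Ideal.pow_le_self N.succ_ne_zero)), Ideal.mul_top]
end

section
/- Let R be a commutative Noetherian ring and J an ideal of R such that J^(N+1) = J^N for some natural number N ≥ 0. If the zero locus V(J) is nowhere dense in Spec R, then J = R. -/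
/-- If the powers of a finitely generated ideal `J` stabilize, then `V(J)` is open. -/
theorem isOpen_zeroLocus_of_pow_succ_eq_pow {R : Type*} [CommRing R] {J : Ideal R} {N : ℕ}
    (hfg : J.FG) (hJ : J ^ (N + 1) = J ^ N) :
    IsOpen (PrimeSpectrum.zeroLocus (J : Set R)) := by
  obtain ⟨r, hr, hrJ⟩ := Submodule.exists_sub_one_mem_and_smul_eq_zero_of_fg_of_le_smul
    J (J ^ N) (Submodule.FG.pow hfg N) (by rw [smul_eq_mul, ← pow_succ', hJ])
  have heq : PrimeSpectrum.zeroLocus (J : Set R) = PrimeSpectrum.basicOpen r := by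
    ext p
    constructor
    · intro hp hrp
      refine p.isPrime.ne_top ((Ideal.eq_top_iff_one _).mpr ?_)
      simpa using p.asIdeal.sub_mem hrp (hp hr)
    · intro hrp x hx
      have hmem : r * x ^ N ∈ p.asIdeal := by
        rw [← smul_eq_mul, hrJ _ (Ideal.pow_mem_pow hx N)]
        exact p.asIdeal.zero_mem
      exact p.isPrime.mem_of_pow_mem N ((p.isPrime.mem_or_mem hmem).resolve_left hrp)
  rw [heq]
  exact (PrimeSpectrum.basicOpen r).isOpen

/-- Let `R` be a commutative Noetherian ring and `J` an ideal with `J ^ (N+1) = J ^ N`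
for some `N`.  If the zero locus `V(J)` is nowhere dense in `Spec R` (i.e. has empty
interior, being closed), then `J = R`. -/
theorem ideal_eq_top_of_pow_succ_eq_pow_of_nowhereDense
    {R : Type*} [CommRing R] [IsNoetherianRing R]
    (J : Ideal R) (N : ℕ) (hJ : J ^ (N + 1) = J ^ N)
    (hnwd : interior (PrimeSpectrum.zeroLocus (J : Set R)) = ∅) :
    J = ⊤ := by
  rwa [(isOpen_zeroLocus_of_pow_succ_eq_pow (IsNoetherian.noetherian J) hJ).interior_eq,
    PrimeSpectrum.zeroLocus_empty_iff_eq_top] at hnwd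
end
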